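/- For every real parameter μ, the function y(ζ) = sinh(μ·arsinh(ζ/2))/√(ζ² + 4) satisfies the Fibonacci-type auxiliary ordinary differential equation (4 + ζ²)·y''(ζ) + 3ζ·y'(ζ) − (μ² − 1)·y(ζ) = 0 for all real ζ. -/

import Mathlib

theorem hasDerivAt_sqrt_sq_add_four (s : ℝ) :
    HasDerivAt (fun s : ℝ => Real.sqrt (s ^ 2 + 4)) (s / Real.sqrt (s ^ 2 + 4)) s := by
  have h : HasDerivAt (fun s : ℝ => s ^ 2 + 4) (2 * s) s := by
    simpa using ((hasDerivAt_id s).pow 2).add_const (4 : ℝ)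
  convert h.sqrt (by positivity) using 1
  rw [mul_div_mul_left _ _ two_ne_zero]

theorem hasDerivAt_arsinh_half (s : ℝ) :
    HasDerivAt (fun s : ℝ => Real.arsinh (s / 2)) (Real.sqrt (s ^ 2 + 4))⁻¹ s := by
  have hw : Real.sqrt (s ^ 2 + 4) = 2 * Real.sqrt (1 + (s / 2) ^ 2) := by
    rw [show s ^ 2 + 4 = 2 ^ 2 * (1 + (s / 2) ^ 2) by ring, Real.sqrt_mul (by positivity),
      Real.sqrt_sq (by norm_num)]
  refine ((hasDerivAt_id' s).div_const 2).arsinh.congr_deriv ?_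
  rw [hw, mul_inv, smul_eq_mul]
  ring

theorem hasDerivAt_sinh_arsinh_div_sqrt (μ s : ℝ) :
    HasDerivAt (fun s : ℝ => Real.sinh (μ * Real.arsinh (s / 2)) / Real.sqrt (s ^ 2 + 4))
      ((μ * Real.cosh (μ * Real.arsinh (s / 2))
        - s * (Real.sinh (μ * Real.arsinh (s / 2)) / Real.sqrt (s ^ 2 + 4))) / (s ^ 2 + 4)) s := by
  have hw : Real.sqrt (s ^ 2 + 4) ≠ 0 := by positivity
  refine (((hasDerivAt_arsinh_half s).const_mul μ).sinh.div
    (hasDerivAt_sqrt_sq_add_four s) hw).congr_deriv ?_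
  rw [Real.sq_sqrt (by positivity)]
  field_simp

/-- For every real parameter `μ`, the function
`y(ζ) = sinh(μ·arsinh(ζ/2))/√(ζ² + 4)` satisfies the Fibonacci-type auxiliary ODE
`(4 + ζ²)·y''(ζ) + 3ζ·y'(ζ) − (μ² − 1)·y(ζ) = 0` for all real `ζ`. -/
theorem sinh_arsinh_over_sqrt_fib_ode (μ : ℝ) :
    ∀ ζ : ℝ,
      (4 + ζ ^ 2) * deriv (deriv
          (fun s : ℝ => Real.sinh (μ * Real.arsinh (s / 2)) / Real.sqrt (s ^ 2 + 4))) ζ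
        + 3 * ζ * deriv
          (fun s : ℝ => Real.sinh (μ * Real.arsinh (s / 2)) / Real.sqrt (s ^ 2 + 4)) ζ
        - (μ ^ 2 - 1) * (Real.sinh (μ * Real.arsinh (ζ / 2)) / Real.sqrt (ζ ^ 2 + 4)) = 0 := by
  intro ζ
  set y : ℝ → ℝ :=
    fun s => Real.sinh (μ * Real.arsinh (s / 2)) / Real.sqrt (s ^ 2 + 4)
  have hy' (s : ℝ) : HasDerivAt y
      ((μ * Real.cosh (μ * Real.arsinh (s / 2)) - s * y s) / (s ^ 2 + 4)) s :=
    hasDerivAt_sinh_arsinh_div_sqrt μ s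
  have hq : ζ ^ 2 + 4 ≠ 0 := by positivity
  have hq' : HasDerivAt (fun s : ℝ => s ^ 2 + 4) (2 * ζ) ζ := by
    simpa using ((hasDerivAt_id ζ).pow 2).add_const (4 : ℝ)
  have hy'' := ((((hasDerivAt_arsinh_half ζ).const_mul μ).cosh.const_mul μ).sub
    ((hasDerivAt_id' ζ).mul (hy' ζ))).div hq' hq
  have hd : deriv y =
      fun s => (μ * Real.cosh (μ * Real.arsinh (s / 2)) - s * y s) / (s ^ 2 + 4) :=
    funext fun s => (hy' s).deriv
  have hyζ : Real.sinh (μ * Real.arsinh (ζ / 2)) / Real.sqrt (ζ ^ 2 + 4) = y ζ := rfl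
  have hS : μ * (Real.sinh (μ * Real.arsinh (ζ / 2)) * (μ * (Real.sqrt (ζ ^ 2 + 4))⁻¹)) =
      μ ^ 2 * y ζ := by
    rw [← hyζ]
    ring
  have hdd := (hy''.congr_of_eventuallyEq (Filter.EventuallyEq.of_eq hd)).deriv
  rw [hdd, hd, hyζ, hS]
  clear_value y
  simp only [Pi.sub_apply, Pi.mul_apply]
  field_simp
  ring
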